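/- arXiv:2405.16319 — 2 statements merged into one kernel-verified Lean document; each statement's English description precedes it below -/
import Mathlib

section
/- Let X be a nonempty set and let k and ℓ be positive kernels on X. If there exists a strong Shimorin certificate for the pair (k, ℓ), then (k, ℓ) is a complete Pick pair. -/
open Matrix
open scoped ComplexOrder

noncomputable section

/-- `k` is a positive (semi-definite) kernel on `X`: every Gram sum is a nonnegative real
(using the partial order on `ℂ`, so `0 ≤ w` means `w` is real and nonnegative). -/
def IsPosKernel {X : Type*} (k : X → X → ℂ) : Prop :=
  ∀ (n : ℕ) (z : Fin n → X) (c : Fin n → ℂ),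
    0 ≤ ∑ i, ∑ j, (starRingEnd ℂ) (c i) * c j * k (z i) (z j)

/-- Positive semidefiniteness of the block matrix `[ℓ(z i, z j)·I − k(z i, z j)·W i (W j)ᴴ]`. -/
def PickBlockPSD {X : Type*} (k ℓ : X → X → ℂ) {n N : ℕ}
    (z : Fin n → X) (W : Fin n → Matrix (Fin N) (Fin N) ℂ) : Prop :=
  ∀ u : Fin n → (Fin N → ℂ),
    0 ≤ ∑ i, ∑ j,
      star (u i) ⬝ᵥ ((ℓ (z i) (z j) • (1 : Matrix (Fin N) (Fin N) ℂ)
        - k (z i) (z j) • (W i * (W j)ᴴ)) *ᵥ u j)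

/-- `Φ` is a contractive multiplier from `k` to `ℓ`. -/
def IsContractiveMultiplier {X : Type*} (k ℓ : X → X → ℂ) {N : ℕ}
    (Φ : X → Matrix (Fin N) (Fin N) ℂ) : Prop :=
  ∀ (n : ℕ) (z : Fin n → X), PickBlockPSD k ℓ z fun i => Φ (z i)

/-- `(k, ℓ)` is a complete Pick pair. -/
def IsCompletePickPair {X : Type*} (k ℓ : X → X → ℂ) : Prop :=
  ∀ (n N : ℕ), 1 ≤ n → 1 ≤ N →
    ∀ (z : Fin n → X) (W : Fin n → Matrix (Fin N) (Fin N) ℂ),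
      PickBlockPSD k ℓ z W →
      ∃ Φ : X → Matrix (Fin N) (Fin N) ℂ,
        IsContractiveMultiplier k ℓ Φ ∧ ∀ i, Φ (z i) = W i

/-- `s` is a strong Shimorin certificate for the pair `(k, ℓ)`: a complete Pick kernel with
`k = (1 − h)·s` and `ℓ = s·g` for some positive kernels `h`, `g`. -/
def IsStrongShimorinCertificate {X : Type*} (k ℓ s : X → X → ℂ) : Prop :=
  IsPosKernel s ∧ IsCompletePickPair s s ∧
    ∃ h g : X → X → ℂ, IsPosKernel h ∧ IsPosKernel g ∧
      (∀ z w, k z w = (1 - h z w) * s z w) ∧ (∀ z w, ℓ z w = s z w * g z w)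

theorem psd_of_nonneg {ι : Type*} [Fintype ι] (M : Matrix ι ι ℂ)
    (h : ∀ v : ι → ℂ, 0 ≤ star v ⬝ᵥ (M *ᵥ v)) : M.PosSemidef := by
  classical
  refine PosSemidef.of_dotProduct_mulVec_nonneg ?_ h
  rw [← Matrix.isSymmetric_toEuclideanLin_iff, LinearMap.isSymmetric_iff_inner_map_self_real]
  intro v
  have := h v.ofLp
  rw [Complex.conj_eq_iff_im]
  have h2 : inner ℂ ((toEuclideanLin M) v) v = star (star v.ofLp ⬝ᵥ (M *ᵥ v.ofLp)) := by
    simp [PiLp.inner_apply, dotProduct, toLpLin_apply]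
  rw [h2]
  have := (Complex.nonneg_iff.1 this).2
  simp [← this]

theorem psd_of_tuple {X : Type*} (A : Matrix X X ℂ)
    (h : ∀ (n : ℕ) (z : Fin n → X), (A.submatrix z z).PosSemidef) : A.PosSemidef := by
  refine ⟨?_, ?_⟩
  · ext a b
    have := (h 2 ![a, b]).isHermitian.apply 0 1
    simpa using this
  · intro x
    have := (h _ (fun i => ((x.support.equivFin.symm i : x.support) : X))).dotProduct_mulVec_nonneg
      (fun i => x (x.support.equivFin.symm i))
    convert this using 1
    simp only [Finsupp.sum, dotProduct, mulVec, Finset.mul_sum, Pi.star_apply, submatrix_apply]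
    rw [← Finset.sum_coe_sort, ← x.support.equivFin.symm.sum_comp]
    refine Finset.sum_congr rfl fun i _ => ?_
    rw [← Finset.sum_coe_sort, ← x.support.equivFin.symm.sum_comp]
    refine Finset.sum_congr rfl fun j _ => ?_
    ring

theorem psd_of_kernel {X : Type*} {k : X → X → ℂ} (hk : IsPosKernel k) :
    (Matrix.of k).PosSemidef := by
  refine psd_of_tuple _ fun n z => psd_of_nonneg _ fun v => ?_
  convert hk n z v using 1
  simp only [dotProduct, mulVec, Finset.mul_sum, Pi.star_apply, submatrix_apply]
  refine Finset.sum_congr rfl fun i _ => Finset.sum_congr rfl fun j _ => ?_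
  simp
  ring

theorem psd_zeroext {α β : Type*} [Fintype α] [Fintype β] (A : Matrix β β ℂ) (e : α → β)
    (he : Function.Injective e) (h : (A.submatrix e e).PosSemidef)
    (h0 : ∀ b c, b ∉ Set.range e → A b c = 0) (h1 : ∀ b c, b ∉ Set.range e → A c b = 0) :
    A.PosSemidef := by
  refine psd_of_nonneg _ fun v => ?_
  convert h.dotProduct_mulVec_nonneg (v ∘ e) using 1
  simp only [dotProduct, mulVec]
  symm
  apply Fintype.sum_of_injective e he
  · intro i hi
    simp [h0 i _ hi]
  · intro i
    simp only [Pi.star_apply, Function.comp_apply]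
    congr 1
    apply Fintype.sum_of_injective e he
    · intro j hj
      simp [h1 j _ hj]
    · intro j
      simp

theorem psd_shift {X : Type*} (T : Matrix X X ℂ) (hT : T.PosSemidef) (x : X) (σ : X → ℂ) :
    (Matrix.of fun z w => T z w - star (σ z) * T x w - T z x * σ w
      + star (σ z) * T x x * σ w).PosSemidef := by
  refine psd_of_tuple _ fun n z => ?_
  have h := (hT.submatrix (fun o : Option (Fin n) => o.elim x z)).conjTranspose_mul_mul_same
    (Matrix.of fun o (i : Fin n) => Option.elim o (- σ (z i)) (fun j => if j = i then 1 else 0))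
  convert h using 1
  ext i j
  simp [Matrix.mul_apply, Fintype.sum_option]
  ring

theorem psd_rank1 {X : Type*} (a : X → ℂ) : (Matrix.of fun z w => a z * star (a w)).PosSemidef := by
  refine psd_of_tuple _ fun n z => ?_
  exact posSemidef_vecMulVec_self_star (fun i => a (z i))

theorem psd_fac {X p : Type*} [Fintype p] (V : X → p → ℂ) :
    (Matrix.of fun z w => ∑ b, V z b * star (V w b)).PosSemidef := by
  refine psd_of_tuple _ fun n z => ?_
  exact posSemidef_self_mul_conjTranspose (Matrix.of fun i => V (z i))

theorem psd_mul {X : Type*} {a b : X → X → ℂ} (ha : (Matrix.of a).PosSemidef)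
    (hb : (Matrix.of b).PosSemidef) : (Matrix.of fun z w => a z w * b z w).PosSemidef :=
  ha.hadamard hb

theorem psd_exists_fac {α : Type*} [Fintype α] {P : Matrix α α ℂ} (hP : P.PosSemidef) :
    ∃ T : Matrix α α ℂ, P = T * Tᴴ := by
  classical
  open scoped MatrixOrder in
  have h := (CStarAlgebra.nonneg_iff_eq_mul_star_self (a := P)).1 hP.nonneg
  exact h
def BK {X ι : Type*} {N : ℕ} (k ℓ : X → X → ℂ) (z : ι → X)
    (W : ι → Matrix (Fin N) (Fin N) ℂ) : Matrix (ι × Fin N) (ι × Fin N) ℂ :=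
  Matrix.of fun p q => ℓ (z p.1) (z q.1) * (1 : Matrix (Fin N) (Fin N) ℂ) p.2 q.2
    - k (z p.1) (z q.1) * ∑ b, W p.1 p.2 b * star (W q.1 q.2 b)

theorem BK_quad {X : Type*} {n N : ℕ} (k ℓ : X → X → ℂ) (z : Fin n → X)
    (W : Fin n → Matrix (Fin N) (Fin N) ℂ) (v : Fin n × Fin N → ℂ) :
    star v ⬝ᵥ (BK k ℓ z W *ᵥ v) = ∑ i, ∑ j,
      star (fun a => v (i, a)) ⬝ᵥ ((ℓ (z i) (z j) • (1 : Matrix (Fin N) (Fin N) ℂ)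
        - k (z i) (z j) • (W i * (W j)ᴴ)) *ᵥ (fun a => v (j, a))) := by
  simp only [dotProduct, mulVec, Fintype.sum_prod_type, Finset.mul_sum, BK, Matrix.of_apply,
    Matrix.sub_apply, Matrix.smul_apply, smul_eq_mul, Matrix.mul_apply, conjTranspose_apply,
    Pi.star_apply]
  refine Finset.sum_congr rfl fun i _ => ?_
  rw [Finset.sum_comm]

theorem BK_iff {X : Type*} {n N : ℕ} (k ℓ : X → X → ℂ) (z : Fin n → X)
    (W : Fin n → Matrix (Fin N) (Fin N) ℂ) :
    PickBlockPSD k ℓ z W ↔ (BK k ℓ z W).PosSemidef := by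
  constructor
  · intro h
    refine psd_of_nonneg _ fun v => ?_
    rw [BK_quad]
    exact h _
  · intro h u
    have := h.dotProduct_mulVec_nonneg (fun p => u p.1 p.2)
    rw [BK_quad] at this
    exact this

def sz {X : Type*} (s : X → X → ℂ) (x z w : X) : ℂ := s z w - s z x * s x w / s x x

theorem herm {X : Type*} {s : X → X → ℂ} (hS : (Matrix.of s).PosSemidef) (z w : X) :
    star (s z w) = s w z := hS.isHermitian.apply w z

theorem psd_sz {X : Type*} {s : X → X → ℂ} (hS : (Matrix.of s).PosSemidef) (x : X)
    (hx : s x x ≠ 0) : (Matrix.of (sz s x)).PosSemidef := by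
  have h := psd_shift _ hS x (fun w => s x w / s x x)
  convert h using 1
  ext z w
  simp only [Matrix.of_apply, sz, star_div₀, herm hS]
  field_simp
  ring

theorem psd_r {X : Type*} {s : X → X → ℂ} (hS : (Matrix.of s).PosSemidef) (x : X) :
    (Matrix.of fun z w => s z x * s x w / s x x).PosSemidef := by
  have h0 : 0 ≤ (s x x)⁻¹ := inv_nonneg_of_nonneg (hS.diag_nonneg (i := x))
  convert (psd_rank1 (fun z => s z x)).smul h0 using 1
  ext z w
  simp only [Matrix.of_apply, Matrix.smul_apply, smul_eq_mul, herm hS]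
  ring

theorem stepA0 {X : Type*} {p : Type*} [Fintype p] {s : X → X → ℂ} (hS : (Matrix.of s).PosSemidef)
    (x : X) (hx : s x x ≠ 0) (V : X → p → ℂ)
    (h : (Matrix.of fun z w => s z w * (1 - ∑ b, V z b * star (V w b))).PosSemidef) :
    (Matrix.of fun z w => sz s x z w * (1 - ∑ b, V z b * star (V w b))).PosSemidef := by
  have h1 := psd_shift _ h x (fun w => s x w / s x x)
  have h2 := psd_mul (psd_r hS x) (psd_fac (fun z b => V z b - V x b))
  convert h1.add h2 using 1
  ext z w
  simp only [Matrix.of_apply, Matrix.add_apply, sz, star_div₀, herm hS, star_sub, sub_mul, mul_sub,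
    Finset.sum_sub_distrib]
  field_simp
  ring

theorem stepA {X : Type*} {s : X → X → ℂ} (hS : (Matrix.of s).PosSemidef)
    (hp : IsCompletePickPair s s)
    (x : X) (hx : s x x ≠ 0) (n : ℕ) (z : Fin n → X) (β : Matrix (Fin n) (Fin n) ℂ)
    (hβ : β.PosSemidef)
    (h : (Matrix.of fun i j => s (z i) (z j) * (1 - β i j)).PosSemidef) :
    (Matrix.of fun i j => sz s x (z i) (z j) * (1 - β i j)).PosSemidef := by
  rcases n with _ | m
  · exact psd_of_nonneg _ fun v => by simp
  obtain ⟨T, hT⟩ := psd_exists_fac hβ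
  have hT' : ∀ i j, β i j = ∑ b, T i b * star (T j b) := by
    intro i j
    rw [hT]; simp [Matrix.mul_apply]
  obtain ⟨Φ, hΦ, hΦz⟩ := hp (m+1) (m+1) (by omega) (by omega) z
    (fun i => Matrix.of fun a b => if a = 0 then T i b else 0) (by
      rw [BK_iff]
      have e1 := (psd_mul (h.submatrix (Prod.fst : Fin (m+1) × Fin (m+1) → _))
        (psd_rank1 (fun p : Fin (m+1) × Fin (m+1) => if p.2 = 0 then (1:ℂ) else 0)))
      have hd : (Matrix.diagonal (fun a : Fin (m+1) => if a = 0 then (0:ℂ) else 1)).PosSemidef := by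
        apply PosSemidef.diagonal
        intro a
        dsimp
        split_ifs <;> simp
      have e2 := psd_mul (hS.submatrix (fun p : Fin (m+1) × Fin (m+1) => z p.1))
        (hd.submatrix Prod.snd)
      convert e1.add e2 using 1
      ext ⟨i, a⟩ ⟨j, b⟩
      simp only [BK, Matrix.of_apply, Matrix.add_apply, hT',
        Matrix.diagonal_apply, Matrix.one_apply]
      by_cases ha : a = 0 <;> by_cases hb : b = 0 <;> by_cases hab : a = b <;>
        simp_all
      ring)
  have hV : (Matrix.of fun z w => s z w *
      (1 - ∑ b, Φ z 0 b * star (Φ w 0 b))).PosSemidef := by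
    refine psd_of_tuple _ fun n z => ?_
    convert ((BK_iff _ _ _ _).1 (hΦ n z)).submatrix (fun i => (i, 0)) using 1
    ext i j
    simp [BK]
    ring
  convert (stepA0 hS x hx _ hV).submatrix z using 1
  ext i j
  simp only [Matrix.of_apply, Matrix.submatrix_apply, hΦz, hT']
  simp

theorem stepB {X : Type*} {s : X → X → ℂ} (hS : (Matrix.of s).PosSemidef)
    (hp : IsCompletePickPair s s) (hx : ∀ x, 0 < s x x) (i y j : X)
    (h1 : s i y ≠ 0) (h2 : s i j ≠ 0) : s y j ≠ 0 := by
  intro h0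
  have hi := hx i
  have hy := hx y
  have hj := hx j
  have hne : ∀ x, s x x ≠ 0 := fun x => (hx x).ne'
  have hyi := herm hS i y
  have hji := herm hS i j
  have hnn : 0 ≤ sz s i y y / s y y :=
    div_nonneg ((psd_sz hS i (hne i)).diag_nonneg (i := y)) hy.le
  have hd : (Matrix.diagonal ![0, sz s i y y / s y y]).PosSemidef := by
    apply PosSemidef.diagonal
    intro a
    fin_cases a <;> simp [hnn]
  have := stepA hS hp j (hne j) 2 ![i, y] _ hd (by
    convert (psd_r hS i).submatrix ![i, y] using 1
    ext a b
    have := hne i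
    have := hne y
    fin_cases a <;> fin_cases b <;> simp [sz, Matrix.diagonal_apply] <;> field_simp
    ring)
  have hdet := this.det_nonneg
  have h0' : s j y = 0 := by rw [← herm hS y j, h0]; simp
  have key : 0 < (s i j * s j i) * (s i y * s y i) / (s j j * s i i) := by
    rw [← hyi, ← hji]
    have e1 : ∀ c : ℂ, c ≠ 0 → 0 < c * star c := fun c hc => by
      have : c * star c = ((‖c‖^2 : ℝ) : ℂ) := by
        simpa using Complex.mul_conj' c
      rw [this]
      have : 0 < ‖c‖^2 := by positivity
      exact_mod_cast this
    exact div_pos (mul_pos (e1 _ h2) (e1 _ h1)) (mul_pos hj hi)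
  have : -((s i j * s j i) * (s i y * s y i) / (s j j * s i i)) ≥ 0 := by
    convert hdet using 1
    rw [Matrix.det_fin_two]
    have := hne i
    have := hne y
    have := hne j
    simp [sz, h0, h0']
    field_simp
    ring
  have := neg_nonneg.1 this
  exact absurd key (not_lt_of_ge this)
def bp {X : Type*} (s : X → X → ℂ) (x z w : X) : ℂ :=
  open Classical in if s z x ≠ 0 ∧ s w x ≠ 0 then sz s x z w / s z w else 0

theorem stepC {X : Type*} {s : X → X → ℂ} (hS : (Matrix.of s).PosSemidef)
    (hp : IsCompletePickPair s s) (hx : ∀ x, 0 < s x x) :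
    ∀ (n : ℕ) (z : Fin n → X) (x : X),
      (Matrix.of fun i j => bp s x (z i) (z j)).PosSemidef := by
  classical
  have hne : ∀ x, s x x ≠ 0 := fun x => (hx x).ne'
  have sym : ∀ a b, s a b ≠ 0 → s b a ≠ 0 := by
    intro a b hab
    rw [← herm hS a b]
    simpa using hab
  have tr : ∀ a b c, s a b ≠ 0 → s a c ≠ 0 → s b c ≠ 0 := fun a b c => stepB hS hp hx a b c
  intro n
  induction n with
  | zero => intro z x; exact psd_of_nonneg _ fun v => by simp
  | succ n ih =>
    intro z x
    have hr : ∀ b : Fin (n+1), b ∉ Set.range (Fin.succ : Fin n → Fin (n+1)) → b = 0 := by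
      intro b hb
      by_contra hb0
      exact hb ⟨b.pred hb0, by simp⟩
    by_cases hyx : s (z 0) x = 0
    · refine psd_zeroext _ Fin.succ (Fin.succ_injective n) (ih (fun i => z i.succ) x) ?_ ?_
      · intro b c hb
        simp [hr b hb, bp, hyx]
      · intro b c hb
        simp [hr b hb, bp, hyx]
    · set y := z 0 with hy
      have hny := hne y
      have h1 : (Matrix.of fun i j => bp s y (z i) (z j)).PosSemidef := by
        refine psd_zeroext _ Fin.succ (Fin.succ_injective n) (ih (fun i => z i.succ) y) ?_ ?_
        · intro b c hb
          rw [hr b hb]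
          simp [bp, ← hy, sz, hny]
        · intro b c hb
          rw [hr b hb]
          simp [bp, ← hy, sz, hny]
      have h2 := stepA hS hp x (hne x) (n+1) z _ h1 (by
        convert ((psd_r hS y).add (psd_mul (psd_rank1 (fun w => if s w y = 0 then (1:ℂ) else 0))
          hS)).submatrix z using 1
        ext i j
        simp only [Matrix.of_apply, Matrix.submatrix_apply, Matrix.add_apply, bp]
        by_cases hi : s (z i) y = 0
        · by_cases hj : s (z j) y = 0
          · simp [hi, hj]
          · have : s (z i) (z j) = 0 := by
              by_contra h
              exact tr _ _ _ (sym _ _ h) hj hi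
            simp [hi, hj, this]
        · by_cases hj : s (z j) y = 0
          · have : s (z i) (z j) = 0 := by
              by_contra h
              exact tr _ _ _ h hi hj
            have h5 : s y (z j) = 0 := by
              by_contra h
              exact sym _ _ h hj
            simp [hj, this, h5]
          · have := tr _ _ _ (sym _ _ hi) (sym _ _ hj)
            simp [hi, hj, sz]
            field_simp
            ring)
      have h3 := (psd_mul h2 ((psd_rank1 (fun w => (s w y)⁻¹)).submatrix z)).smul (hx y).le
      convert h3 using 1
      ext i j
      have hcl : ∀ w, s w x ≠ 0 ↔ s w y ≠ 0 := fun w =>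
        ⟨fun h => sym _ _ (tr _ _ _ (sym _ _ hyx) (sym _ _ h)),
         fun h => tr _ _ _ (sym _ _ h) hyx⟩
      simp only [Matrix.of_apply, Matrix.smul_apply, bp, hcl, smul_eq_mul,
        star_inv₀, herm hS]
      by_cases hi : s (z i) y = 0
      · simp [hi]
      · by_cases hj : s (z j) y = 0
        · have : s y (z j) = 0 := by
            by_contra h
            exact sym _ _ h hj
          simp [hj, this]
        · have := tr _ _ _ (sym _ _ hi) (sym _ _ hj)
          have := sym _ _ hj
          simp [hi, hj]
          simp only [sz]
          field_simp
          ring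

theorem stepC' {X : Type*} {s : X → X → ℂ} (hS : (Matrix.of s).PosSemidef)
    (hp : IsCompletePickPair s s) (hx : ∀ x, 0 < s x x) (x : X) :
    ∃ b : X → X → ℂ, (Matrix.of b).PosSemidef ∧ ∀ z w, b z w * s z w = sz s x z w := by
  classical
  have sym : ∀ a b, s a b ≠ 0 → s b a ≠ 0 := by
    intro a b hab
    rw [← herm hS a b]
    simpa using hab
  have tr : ∀ a b c, s a b ≠ 0 → s a c ≠ 0 → s b c ≠ 0 := fun a b c => stepB hS hp hx a b c
  have h1 : (Matrix.of (bp s x)).PosSemidef :=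
    psd_of_tuple _ fun n z => stepC hS hp hx n z x
  refine ⟨_, h1.add (psd_rank1 (fun w => if s w x = 0 then (1:ℂ) else 0)), ?_⟩
  intro z w
  show (bp s x z w + (if s z x = 0 then (1:ℂ) else 0) * star (if s w x = 0 then (1:ℂ) else 0))
    * s z w = _
  simp only [bp]
  by_cases hi : s z x = 0
  · by_cases hj : s w x = 0
    · simp [hi, hj, sz]
    · have : s z w = 0 := by
        by_contra h
        exact tr _ _ _ (sym _ _ h) hj hi
      simp [hi, this, sz]
  · by_cases hj : s w x = 0
    · have : s z w = 0 := by
        by_contra h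
        exact tr _ _ _ h hi hj
      have : s x w = 0 := by
        by_contra h
        exact sym _ _ h hj
      simp [*, sz]
    · have := tr _ _ _ (sym _ _ hi) (sym _ _ hj)
      simp [hi, hj, sz]
      field_simp

theorem nrm {γ : Type*} [Fintype γ] (w : γ → ℂ) :
    star w ⬝ᵥ w = ((‖(WithLp.toLp 2 w : EuclideanSpace ℂ γ)‖ ^ 2 : ℝ) : ℂ) := by
  rw [EuclideanSpace.norm_sq_eq]
  simp [dotProduct, Complex.conj_mul']

theorem hq {γ δ : Type*} [Fintype γ] [Fintype δ] (A : Matrix γ δ ℂ) (v : γ → ℂ) :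
    star v ⬝ᵥ ((A * Aᴴ) *ᵥ v) = star (Aᴴ *ᵥ v) ⬝ᵥ (Aᴴ *ᵥ v) := by
  rw [← Matrix.mulVec_mulVec, star_mulVec, conjTranspose_conjTranspose, dotProduct_mulVec]

theorem douglas {α β p : Type*} [Fintype α] [Fintype β] [Fintype p] [DecidableEq β]
    (T : Matrix α β ℂ) (q : Matrix α p ℂ) (h : (T * Tᴴ - q * qᴴ).PosSemidef) :
    ∃ C : Matrix β p ℂ, q = T * C ∧ (1 - C * Cᴴ).PosSemidef := by
  classical
  let f : EuclideanSpace ℂ α →ₗ[ℂ] EuclideanSpace ℂ β := toEuclideanLin Tᴴ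
  let g : EuclideanSpace ℂ α →ₗ[ℂ] EuclideanSpace ℂ p := toEuclideanLin qᴴ
  have hle : ∀ v, ‖g v‖ ≤ ‖f v‖ := by
    intro v
    have := h.dotProduct_mulVec_nonneg v.ofLp
    rw [Matrix.sub_mulVec, dotProduct_sub, hq, hq, nrm, nrm, sub_nonneg] at this
    have h2 : ‖g v‖ ^ 2 ≤ ‖f v‖ ^ 2 := by exact_mod_cast this
    exact le_of_sq_le_sq h2 (norm_nonneg _)
  obtain ⟨σ, hσ⟩ := f.rangeRestrict.exists_rightInverse_of_surjective
    (LinearMap.range_rangeRestrict f)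
  have hσ' : ∀ y : LinearMap.range f, f (σ y) = y := by
    intro y
    have := LinearMap.congr_fun hσ y
    simpa using congrArg Subtype.val this
  let D : EuclideanSpace ℂ β →ₗ[ℂ] EuclideanSpace ℂ p :=
    (g ∘ₗ σ) ∘ₗ ((LinearMap.range f).orthogonalProjectionOnto : _ →ₗ[ℂ] _)
  have hD : ∀ v, D (f v) = g v := by
    intro v
    have hm : (LinearMap.range f).orthogonalProjectionOnto (f v) = ⟨f v, v, rfl⟩ :=
      Submodule.orthogonalProjectionOnto_mem_subspace_eq_self (⟨f v, v, rfl⟩ : LinearMap.range f)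
    have h0 : f (σ ⟨f v, v, rfl⟩ - v) = 0 := by
      rw [map_sub, hσ', sub_self]
    have h1 := hle (σ ⟨f v, v, rfl⟩ - v)
    rw [h0, norm_zero, map_sub] at h1
    have h2 := sub_eq_zero.1 (norm_le_zero_iff.1 h1)
    show g (σ ((LinearMap.range f).orthogonalProjectionOnto (f v))) = g v
    rw [hm, h2]
  have hDle : ∀ w, ‖D w‖ ≤ ‖w‖ := by
    intro w
    show ‖g (σ ((LinearMap.range f).orthogonalProjectionOnto w))‖ ≤ ‖w‖
    refine (hle _).trans ?_
    rw [hσ']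
    exact Submodule.norm_orthogonalProjectionOnto_apply_le _ w
  let C := (toEuclideanLin.symm D)ᴴ
  have hC : ∀ w, D w = WithLp.toLp 2 (Cᴴ *ᵥ w.ofLp) := by
    intro w
    have : toEuclideanLin Cᴴ = D := by simp [C]
    rw [← this]; rfl
  refine ⟨C, ?_, ?_⟩
  · have : qᴴ = Cᴴ * Tᴴ := by
      apply toEuclideanLin.injective
      ext v : 1
      have := hD v
      rw [hC] at this
      rw [show toEuclideanLin qᴴ v = g v from rfl, ← this]
      simp [f, toLpLin_apply]
    have := congrArg conjTranspose this
    simpa using this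
  · refine psd_of_nonneg _ fun v => ?_
    rw [Matrix.sub_mulVec, dotProduct_sub, hq, Matrix.one_mulVec, nrm, nrm, sub_nonneg]
    have h1 := hDle (WithLp.toLp 2 v)
    rw [hC] at h1
    have : ‖(WithLp.toLp 2 (Cᴴ *ᵥ v) : EuclideanSpace ℂ p)‖ ^ 2
      ≤ ‖(WithLp.toLp 2 v : EuclideanSpace ℂ β)‖ ^ 2 := by
      gcongr
    exact_mod_cast this

theorem parrott {α β p : Type*} [Fintype α] [Fintype β] [Fintype p]
    (P : Matrix β β ℂ) (hP : P.PosSemidef) (e : α → β) (q : Matrix α p ℂ)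
    (h : (P.submatrix e e - q * qᴴ).PosSemidef) :
    ∃ Z : Matrix β p ℂ, (∀ a b, Z (e a) b = q a b) ∧ (P - Z * Zᴴ).PosSemidef := by
  classical
  obtain ⟨T, rfl⟩ := psd_exists_fac hP
  obtain ⟨C, hC, hC1⟩ := douglas (T.submatrix e id) q (by
    convert h using 2
    ext i j
    simp [Matrix.mul_apply])
  refine ⟨T * C, ?_, ?_⟩
  · intro a b
    rw [hC]
    rfl
  · convert hC1.mul_mul_conjTranspose_same T using 1
    simp [Matrix.mul_sub, Matrix.sub_mul, Matrix.mul_assoc]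
theorem psd_hs {X : Type*} {h : X → X → ℂ} (hh : (Matrix.of h).PosSemidef) (x : X)
    (hx : 0 < 1 - h x x) :
    (Matrix.of fun z w => h z w - 1 + (1 - h z x) * (1 - h x w) / (1 - h x x)).PosSemidef := by
  have h0 : 0 ≤ (1 - h x x)⁻¹ := inv_nonneg_of_nonneg hx.le
  have hne := hx.ne'
  convert (psd_shift _ hh x (fun _ => 1)).add
    ((psd_rank1 (fun z => h z x - h x x)).smul h0) using 1
  ext z w
  simp only [Matrix.of_apply, Matrix.add_apply, Matrix.smul_apply, smul_eq_mul, star_sub, herm hh,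
    star_one]
  field_simp
  ring

theorem stepE {X : Type*} {k ℓ s h g : X → X → ℂ}
    (hK : (Matrix.of k).PosSemidef) (hkd : ∀ x, 0 < k x x)
    (hS : (Matrix.of s).PosSemidef) (hp : IsCompletePickPair s s)
    (hh : (Matrix.of h).PosSemidef) (hg : (Matrix.of g).PosSemidef)
    (hk : ∀ z w, k z w = (1 - h z w) * s z w) (hl : ∀ z w, ℓ z w = s z w * g z w)
    {ι : Type*} [Fintype ι] {N : ℕ} (z : ι → X) (W : ι → Matrix (Fin N) (Fin N) ℂ)
    (hB : (BK k ℓ z W).PosSemidef) (x : X) :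
    ∃ W0 : Matrix (Fin N) (Fin N) ℂ,
      (BK k ℓ (fun o : Option ι => o.elim x z) (fun o => o.elim W0 W)).PosSemidef := by
  classical
  have hsx : ∀ x, 0 < s x x := by
    intro x
    refine lt_of_le_of_ne (hS.diag_nonneg (i := x)) ?_
    intro h0
    have := hkd x
    rw [hk, ← h0] at this
    simp at this
  have hhx : ∀ x, 0 < 1 - h x x := by
    intro x
    have := div_pos (hkd x) (hsx x)
    rwa [hk, mul_div_assoc, div_self (hsx x).ne', mul_one] at this
  obtain ⟨b, hb, hbs⟩ := stepC' hS hp hsx x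
  have hsne := (hsx x).ne'
  have hhne := (hhx x).ne'
  obtain ⟨c, hc, hck⟩ : ∃ c : ℝ, 0 < c ∧ (c : ℂ) * c = k x x := by
    have h1 := Complex.pos_iff.1 (hkd x)
    refine ⟨√(k x x).re, Real.sqrt_pos.2 h1.1, ?_⟩
    rw [← Complex.ofReal_mul, Real.mul_self_sqrt h1.1.le]
    apply Complex.ext <;> simp [h1.2]
  have hcne : (c : ℂ) ≠ 0 := by exact_mod_cast hc.ne'
  let zz : Option ι × Fin N → X := fun p => p.1.elim x z
  let V : Option ι × Fin N → Fin N → ℂ := fun p a => p.1.elim 0 (fun i => W i p.2 a)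
  let A : Matrix (Option ι × Fin N) (Option ι × Fin N) ℂ := Matrix.of fun p q =>
    p.1.elim 0 (fun i => q.1.elim 0 (fun j => b (z i) (z j) * BK k ℓ z W (i, p.2) (j, q.2)))
  let e : ι × Fin N → Option ι × Fin N := fun p => (some p.1, p.2)
  have hA : A.PosSemidef := by
    refine psd_zeroext A e ?_ ?_ ?_ ?_
    · rintro ⟨i, a⟩ ⟨j, a'⟩ hh
      simpa [e] using hh
    · exact psd_mul (hb.submatrix (fun p : ι × Fin N => z p.1)) hB
    · rintro ⟨o, a⟩ q hh
      rcases o with _ | i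
      · simp [A]
      · exact absurd ⟨(i, a), rfl⟩ hh
    · rintro ⟨o, a⟩ ⟨o', a'⟩ hh
      rcases o with _ | i
      · rcases o' with _ | j <;> simp [A]
      · exact absurd ⟨(i, a), rfl⟩ hh
  have hI : (Matrix.of fun p q : Option ι × Fin N =>
      (1 : Matrix (Fin N) (Fin N) ℂ) p.2 q.2).PosSemidef :=
    (PosSemidef.one (R := ℂ) (n := Fin N)).submatrix Prod.snd
  have h1 := psd_mul ((psd_r hS x).submatrix zz) (psd_mul (hg.submatrix zz) hI)
  have h2 := psd_mul ((psd_r hS x).submatrix zz)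
    (psd_mul ((psd_hs hh x (hhx x)).submatrix zz) (psd_fac V))
  let P : Matrix (Option ι × Fin N) (Option ι × Fin N) ℂ := Matrix.of fun p q =>
    ℓ (zz p) (zz q) * (1 : Matrix (Fin N) (Fin N) ℂ) p.2 q.2
      - (k (zz p) (zz q) - k (zz p) x * k x (zz q) / k x x) * ∑ a, V p a * star (V q a)
  have hkne := (hkd x).ne'
  have hP : P.PosSemidef := by
    convert (hA.add h1).add h2 using 1
    ext ⟨o, a⟩ ⟨o', a'⟩
    rcases o with _ | i
    · simp [P, A, zz, V, hl]
      field_simp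
    · rcases o' with _ | j
      · simp [P, A, zz, V, hl]
        field_simp
      · have hb1 := hbs (z i) (z j)
        simp only [P, A, zz, V, hl, hk, BK, Matrix.of_apply, Matrix.add_apply, Option.elim]
        generalize (∑ b, W i a b * star (W j a' b)) = S
        generalize (1 : Matrix (Fin N) (Fin N) ℂ) a a' = d
        have e1 : b (z i) (z j) * (s (z i) (z j) * g (z i) (z j) * d
            - (1 - h (z i) (z j)) * s (z i) (z j) * S)
          = sz s x (z i) (z j) * (g (z i) (z j) * d - (1 - h (z i) (z j)) * S) := by
          rw [← hb1]; ring
        rw [e1, sz]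
        field_simp
        ring
  let q : Matrix (ι × Fin N) (Fin N) ℂ := Matrix.of fun p a => k (z p.1) x / c * W p.1 p.2 a
  obtain ⟨Z, hZq, hZ⟩ := parrott P hP e q (by
    convert hB using 1
    ext ⟨i, a⟩ ⟨j, a'⟩
    simp only [P, q, e, zz, V, BK, Matrix.of_apply, Matrix.sub_apply, Matrix.submatrix_apply,
      Matrix.mul_apply, conjTranspose_apply, Option.elim, star_mul', star_div₀, herm hK]
    have : ∑ m, k (z i) x / c * W i a m * (k x (z j) / star (c : ℂ) * star (W j a' m))
      = k (z i) x * k x (z j) / k x x * ∑ m, W i a m * star (W j a' m) := by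
      rw [Finset.mul_sum]
      refine Finset.sum_congr rfl fun m _ => ?_
      rw [← hck, show star (c : ℂ) = c from Complex.conj_ofReal c]
      field_simp
    rw [this]
    ring)
  refine ⟨Matrix.of fun a m => Z (none, a) m / c, ?_⟩
  convert hZ using 1
  have hZq' : ∀ i a m, Z (some i, a) m = k (z i) x / c * W i a m := fun i a m => hZq (i, a) m
  have hcs : star (c : ℂ) = c := Complex.conj_ofReal c
  ext ⟨o, a⟩ ⟨o', a'⟩
  rcases o with _ | i <;> rcases o' with _ | j <;>
    simp only [P, zz, V, BK, Matrix.of_apply, Matrix.sub_apply, hZq', Matrix.mul_apply,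
      conjTranspose_apply, Option.elim, star_mul', star_div₀, herm hK, hcs, zero_mul,
      star_zero, mul_zero, Finset.sum_const_zero, sub_zero]
  · congr 1
    rw [Finset.mul_sum]
    refine Finset.sum_congr rfl fun m _ => ?_
    rw [← hck]; field_simp
  · congr 1
    rw [Finset.mul_sum]
    refine Finset.sum_congr rfl fun m _ => ?_
    field_simp
  · congr 1
    rw [Finset.mul_sum]
    refine Finset.sum_congr rfl fun m _ => ?_
    field_simp
  · have : ∑ m, k (z i) x / c * W i a m * (k x (z j) / (c : ℂ) * star (W j a' m))
      = k (z i) x * k x (z j) / k x x * ∑ m, W i a m * star (W j a' m) := by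
      rw [Finset.mul_sum]
      refine Finset.sum_congr rfl fun m _ => ?_
      rw [← hck]
      field_simp
    rw [this]
    ring

theorem BK_sub {X ι κ : Type*} {N : ℕ} {k ℓ : X → X → ℂ} {z : ι → X}
    {W : ι → Matrix (Fin N) (Fin N) ℂ} (h : (BK k ℓ z W).PosSemidef) (e : κ → ι)
    {z' : κ → X} {W' : κ → Matrix (Fin N) (Fin N) ℂ} (hz : ∀ a, z' a = z (e a))
    (hW : ∀ a, W' a = W (e a)) : (BK k ℓ z' W').PosSemidef := by
  obtain rfl : z' = z ∘ e := funext hz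
  obtain rfl : W' = W ∘ e := funext hW
  exact h.submatrix (Prod.map e id)

theorem BK_bound {X ι : Type*} {N : ℕ} {k ℓ : X → X → ℂ} {z : ι → X}
    {W : ι → Matrix (Fin N) (Fin N) ℂ} (h : (BK k ℓ z W).PosSemidef)
    (hkd : ∀ x, 0 < k x x) (i : ι) (a b : Fin N) :
    ‖W i a b‖ ≤ √((ℓ (z i) (z i)).re / (k (z i) (z i)).re) := by
  have h1 := h.diag_nonneg (i := (i, a))
  have h2 := Complex.pos_iff.1 (hkd (z i))
  have h3 : (k (z i) (z i)) = (((k (z i) (z i)).re : ℝ) : ℂ) := by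
    apply Complex.ext <;> simp [h2.2]
  have h4 : ∑ m, W i a m * star (W i a m) = ((∑ m, ‖W i a m‖ ^ 2 : ℝ) : ℂ) := by
    push_cast
    refine Finset.sum_congr rfl fun m _ => ?_
    simpa using Complex.mul_conj' (W i a m)
  simp only [BK, Matrix.of_apply, Matrix.one_apply_eq, mul_one] at h1
  rw [h4, h3, ← Complex.ofReal_mul] at h1
  have h5 := (Complex.nonneg_iff.1 h1).1
  rw [Complex.sub_re, Complex.ofReal_re] at h5
  apply Real.le_sqrt_of_sq_le
  rw [le_div_iff₀ h2.1]
  have h6 : ‖W i a b‖ ^ 2 ≤ ∑ m, ‖W i a m‖ ^ 2 :=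
    Finset.single_le_sum (f := fun m => ‖W i a m‖ ^ 2) (fun _ _ => by positivity)
      (Finset.mem_univ b)
  nlinarith [h2.1]

theorem BK_rep {X ι : Type*} {N : ℕ} {k ℓ : X → X → ℂ} {z : ι → X}
    {W : ι → Matrix (Fin N) (Fin N) ℂ} (h : (BK k ℓ z W).PosSemidef)
    (hkd : ∀ x, 0 < k x x) (i j : ι) (hij : z i = z j) : W i = W j := by
  have h1 := (h.submatrix (fun p : Fin 2 × Fin N => (![i, j] p.1, p.2))).conjTranspose_mul_mul_same
    (Matrix.of fun (p : Fin 2 × Fin N) (a : Fin N) =>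
      (![1, -1] p.1 : ℂ) * (if p.2 = a then 1 else 0))
  have h2 : (BK (fun z w => k z w) (fun _ _ => 0) (fun _ : Unit => z i)
      (fun _ => W i - W j)).PosSemidef := by
    convert h1.submatrix (Prod.snd : Unit × Fin N → _) using 1
    ext ⟨_, a⟩ ⟨_, b⟩
    have hst : ∀ x : Fin N, (starRingEnd ℂ) (if x = a then -1 else 0)
        = if x = a then -1 else 0 := by
      intro x
      split_ifs <;> simp
    simp [BK, Matrix.mul_apply, Fintype.sum_prod_type, hij, hst]
    simp only [sub_mul, mul_sub, Finset.sum_sub_distrib]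
    ring
  ext a b
  have := BK_bound h2 hkd () a b
  simpa [sub_eq_zero] using this

theorem ext_finite {X : Type*} {k ℓ : X → X → ℂ} {N : ℕ}
    (hE : ∀ (ι : Finset X) (z : ι → X) (W : ι → Matrix (Fin N) (Fin N) ℂ)
      (_ : (BK k ℓ z W).PosSemidef) (x : X),
      ∃ W0 : Matrix (Fin N) (Fin N) ℂ,
        (BK k ℓ (fun o : Option ι => o.elim x z) (fun o => o.elim W0 W)).PosSemidef)
    (F : Finset X) (Φ₀ : X → Matrix (Fin N) (Fin N) ℂ)
    (h0 : (BK k ℓ (fun i : F => (i : X)) (fun i => Φ₀ i)).PosSemidef) [DecidableEq X]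
    (G : Finset X) :
    ∃ Φ : X → Matrix (Fin N) (Fin N) ℂ, (∀ x ∈ F, Φ x = Φ₀ x) ∧
      (BK k ℓ (fun i : (F ∪ G : Finset X) => (i : X)) (fun i => Φ i)).PosSemidef := by
  induction G using Finset.induction_on with
  | empty =>
    refine ⟨Φ₀, fun _ _ => rfl, ?_⟩
    exact BK_sub h0 (fun i : (F ∪ ∅ : Finset X) => (⟨i, by simpa using i.2⟩ : F)) (fun _ => rfl) (fun _ => rfl)
  | insert a G _ ih =>
    obtain ⟨Φ, h1, h2⟩ := ih
    obtain ⟨W0, hW0⟩ := hE _ _ _ h2 a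
    refine ⟨fun y => if y ∈ F ∪ G then Φ y else W0, ?_, ?_⟩
    · intro x hx
      simp only [if_pos (Finset.mem_union_left G hx), h1 x hx]
    · refine BK_sub hW0 (fun y : (F ∪ insert a G : Finset X) =>
        if h : (y : X) ∈ F ∪ G then some (⟨y, h⟩ : (F ∪ G : Finset X)) else none) ?_ ?_
      · rintro ⟨y, hy⟩
        by_cases h : y ∈ F ∪ G
        · simp only [h, dite_true, Option.elim]
        · simp only [h, dite_false, Option.elim]
          simp only [Finset.mem_union, Finset.mem_insert] at hy h
          tauto
      · rintro ⟨y, hy⟩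
        by_cases h : y ∈ F ∪ G
        · simp only [h, dite_true, Option.elim, if_true]
        · simp only [h, dite_false, Option.elim, if_false]

/-- **Shimorin's theorem.** If there exists a strong Shimorin certificate for `(k, ℓ)`,
then `(k, ℓ)` is a complete Pick pair. -/
theorem shimorin_sufficiency {X : Type*} [Nonempty X] (k ℓ : X → X → ℂ)
    (hk : IsPosKernel k) (hℓ : IsPosKernel ℓ)
    (hkd : ∀ x, 0 < k x x) (hℓd : ∀ x, 0 < ℓ x x)
    (s : X → X → ℂ) (hs : IsStrongShimorinCertificate k ℓ s) :
    IsCompletePickPair k ℓ := by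
  classical
  obtain ⟨hs1, hs2, h, g, hh, hg, hkh, hlg⟩ := hs
  intro n N hn hN z W hPsd
  rw [BK_iff] at hPsd
  have hE := fun (ι : Finset X) (z : ι → X) (W : ι → Matrix (Fin N) (Fin N) ℂ) =>
    stepE (psd_of_kernel hk) hkd (psd_of_kernel hs1) hs2 (psd_of_kernel hh) (psd_of_kernel hg)
      hkh hlg z W
  let F : Finset X := Finset.univ.image z
  let Φ₀ : X → Matrix (Fin N) (Fin N) ℂ := fun x => if h : ∃ i, z i = x then W h.choose else 0
  have hΦ₀ : ∀ i, Φ₀ (z i) = W i := by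
    intro i
    have hex : ∃ j, z j = z i := ⟨i, rfl⟩
    simp only [Φ₀, dif_pos hex]
    exact BK_rep hPsd hkd _ _ hex.choose_spec
  have hF : ∀ x : F, ∃ i, z i = x := fun x => by
    obtain ⟨x, hx⟩ := x
    simpa [F] using hx
  choose f hf using hF
  have h0 : (BK k ℓ (fun i : F => (i : X)) (fun i => Φ₀ i)).PosSemidef :=
    BK_sub hPsd f (fun a => (hf a).symm) (fun a => by rw [← hΦ₀, hf])
  let K : Set (X → Fin N → Fin N → ℂ) := Set.pi Set.univ fun x => Set.pi Set.univ fun _ =>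
    Set.pi Set.univ fun _ => Metric.closedBall 0 (√((ℓ x x).re / (k x x).re))
  have hKc : IsCompact K := isCompact_univ_pi fun x => isCompact_univ_pi fun _ =>
    isCompact_univ_pi fun _ => isCompact_closedBall _ _
  let t : Finset X → Set (X → Fin N → Fin N → ℂ) := fun G =>
    {Φ | (BK k ℓ (fun i : G => (i : X)) (fun i => Matrix.of (Φ i))).PosSemidef ∧
      ∀ i, Φ (z i) = fun a b => W i a b}
  have htc : ∀ G, IsClosed (t G) := by
    intro G
    have hsplit : t G = {Φ : X → Fin N → Fin N → ℂ |
          (BK k ℓ (fun i : G => (i : X)) (fun i => Matrix.of (Φ i))).PosSemidef} ∩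
        {Φ : X → Fin N → Fin N → ℂ | ∀ i, Φ (z i) = fun a b => W i a b} := rfl
    rw [hsplit]
    refine IsClosed.inter ?_ ?_
    · have : {Φ : X → Fin N → Fin N → ℂ |
          (BK k ℓ (fun i : G => (i : X)) (fun i => Matrix.of (Φ i))).PosSemidef}
        = ⋂ v : G × Fin N → ℂ, {Φ | 0 ≤ star v ⬝ᵥ
          (BK k ℓ (fun i : G => (i : X)) (fun i => Matrix.of (Φ i)) *ᵥ v)} := by
        ext Φ
        simp only [Set.mem_ofPred_eq, Set.mem_iInter]
        exact ⟨fun h v => h.dotProduct_mulVec_nonneg v, fun h => psd_of_nonneg _ h⟩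
      rw [this]
      refine isClosed_iInter fun v => isClosed_le continuous_const ?_
      simp only [dotProduct, mulVec, BK, Matrix.of_apply]
      fun_prop
    · have : {Φ : X → Fin N → Fin N → ℂ | ∀ i, Φ (z i) = fun a b => W i a b}
        = ⋂ i, {Φ | Φ (z i) = fun a b => W i a b} := by
        ext Φ; simp
      rw [this]
      exact isClosed_iInter fun i => isClosed_eq (continuous_apply _) continuous_const
  obtain ⟨Φ, -, hΦ⟩ := hKc.inter_iInter_nonempty t htc (by
    intro u
    obtain ⟨Φ, h1, h2⟩ := ext_finite hE F Φ₀ h0 (u.sup id)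
    refine ⟨fun x a b => if x ∈ F ∪ u.sup id then Φ x a b else 0, ?_, ?_⟩
    · intro x _ a _ b _
      rw [mem_closedBall_zero_iff]
      dsimp only
      split_ifs with hx
      · exact BK_bound h2 hkd ⟨x, hx⟩ a b
      · simp
    · simp only [Set.mem_iInter]
      intro G hG
      have hsub : ∀ x ∈ G, x ∈ F ∪ u.sup id := fun x hx =>
        Finset.mem_union_right _ ((Finset.le_sup (f := id) hG) hx)
      refine ⟨BK_sub h2 (fun i : G => (⟨i, hsub i i.2⟩ : (F ∪ u.sup id : Finset X))) (fun _ => rfl) ?_, ?_⟩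
      · intro i
        ext a b
        simp only [Matrix.of_apply, if_pos (hsub i i.2)]
      · intro i
        have hi : z i ∈ F := by simp [F]
        ext a b
        simp only [if_pos (Finset.mem_union_left _ hi), h1 _ hi, hΦ₀])
  rw [Set.mem_iInter] at hΦ
  refine ⟨fun x => Matrix.of (Φ x), ?_, ?_⟩
  · intro m y
    rw [BK_iff]
    exact BK_sub (hΦ (Finset.univ.image y)).1 (fun i => ⟨y i, by simp⟩) (fun _ => rfl)
      (fun _ => rfl)
  · intro i
    ext a b
    have := (hΦ ∅).2 i
    simp [this]
end
end

section
/- Let X be a nonempty set and let k and ℓ be positive kernels on X. If the pair (k, ℓ) possesses a Shimorin certificate, then (k, ℓ) is a complete Pick pair. -/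
open Matrix
open scoped ComplexOrder

noncomputable section

/-- The kernel `ℓ^z (w, v) = ℓ(w,v) − ℓ(w,z)·ℓ(z,v)/ℓ(z,z)` of the subspace of functions
vanishing at `z`. -/
def kerShift {X : Type*} (ℓ : X → X → ℂ) (z : X) (w v : X) : ℂ :=
  ℓ w v - ℓ w z * ℓ z v / ℓ z z

/-- A Shimorin certificate for `(k, ℓ)`: a family `p[z]` of positive kernels with
`ℓ^z ⪰ p[z]·ℓ` and `p[z]·k ⪰ k^z` for every `z`. -/
def IsShimorinCertificate {X : Type*} (k ℓ : X → X → ℂ) (p : X → X → X → ℂ) : Prop :=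
  ∀ z : X, IsPosKernel (p z) ∧
    IsPosKernel (fun w v => kerShift ℓ z w v - p z w v * ℓ w v) ∧
    IsPosKernel (fun w v => p z w v * k w v - kerShift k z w v)


theorem gram_of_form {T : Type*} [Fintype T] (q : T → T → ℂ)
    (h : ∀ c : T → ℂ, 0 ≤ ∑ i, ∑ j, star (c i) * q i j * c j) :
    ∃ B : Matrix T T ℂ, ∀ i j, q i j = ∑ m, star (B m i) * B m j := by
  classical
  have h1 : ∀ x : T → ℂ, 0 ≤ star x ⬝ᵥ ((Matrix.of q) *ᵥ x) := by
    intro x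
    have := h x
    simpa [dotProduct, mulVec, Finset.mul_sum, mul_assoc] using this
  have hH : (Matrix.of q).IsHermitian := by
    rw [← Matrix.isSymmetric_toEuclideanLin_iff, LinearMap.isSymmetric_iff_inner_map_self_real]
    intro v
    have h2 := h1 (WithLp.ofLp v)
    have h3 : inner ℂ (Matrix.toEuclideanLin (Matrix.of q) v) v
        = star (star (WithLp.ofLp v) ⬝ᵥ ((Matrix.of q) *ᵥ (WithLp.ofLp v))) := by
      rw [← inner_conj_symm]
      simp [EuclideanSpace.inner_eq_star_dotProduct, dotProduct_comm]
    rw [h3]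
    have := (IsSelfAdjoint.of_nonneg h2).star_eq
    rw [this]
    exact this
  have hP : (Matrix.of q).PosSemidef := posSemidef_iff_dotProduct_mulVec.2 ⟨hH, h1⟩
  open scoped MatrixOrder in
  obtain ⟨B, hB⟩ := CStarAlgebra.nonneg_iff_eq_star_mul_self.mp hP.nonneg
  refine ⟨B, fun i j => ?_⟩
  have := congrFun (congrFun hB i) j
  simpa [Matrix.mul_apply, Matrix.star_apply] using this

theorem posKernel_finset {X : Type*} {k : X → X → ℂ} (hk : IsPosKernel k) (s : Finset X)
    (c : X → ℂ) : 0 ≤ ∑ i ∈ s, ∑ j ∈ s, star (c i) * c j * k i j := by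
  have := hk s.card (fun i => (s.equivFin.symm i : X)) (fun i => c (s.equivFin.symm i))
  have e1 : ∀ f : X → ℂ, ∑ i ∈ s, f i = ∑ i : Fin s.card, f (s.equivFin.symm i : X) := by
    intro f
    rw [← Finset.sum_coe_sort, ← s.equivFin.symm.sum_comp]
  simp only [e1]
  exact this

theorem posKernel_gram {X : Type*} {k : X → X → ℂ} (hk : IsPosKernel k) (s : Finset X) :
    ∃ B : s → X → ℂ, ∀ i ∈ s, ∀ j ∈ s, k i j = ∑ m, star (B m i) * B m j := by
  classical
  obtain ⟨B, hB⟩ := gram_of_form (T := s) (fun i j => k i j) (by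
    intro c
    have := posKernel_finset hk s (fun x => if hx : x ∈ s then c ⟨x, hx⟩ else 0)
    rw [← Finset.sum_coe_sort] at this
    simp only [← Finset.sum_coe_sort s] at this
    convert this using 1
    refine Finset.sum_congr rfl fun i _ => Finset.sum_congr rfl fun j _ => ?_
    simp only [Finset.coe_mem, dif_pos]
    ring)
  refine ⟨fun m x => if hx : x ∈ s then B m ⟨x, hx⟩ else 0, fun i hi j hj => ?_⟩
  have := hB ⟨i, hi⟩ ⟨j, hj⟩
  simp [this, hi, hj]

theorem posKernel_star {X : Type*} {k : X → X → ℂ} (hk : IsPosKernel k) (x y : X) :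
    star (k x y) = k y x := by
  classical
  obtain ⟨B, hB⟩ := posKernel_gram hk {x, y}
  rw [hB x (by simp) y (by simp), hB y (by simp) x (by simp), star_sum]
  simp [mul_comm]

def QForm {X : Type*} {N : ℕ} (s : Finset X) (Q : X → X → Matrix (Fin N) (Fin N) ℂ)
    (u : X → Fin N → ℂ) : ℂ := ∑ i ∈ s, ∑ j ∈ s, star (u i) ⬝ᵥ (Q i j *ᵥ u j)

def BPSD {X : Type*} {N : ℕ} (s : Finset X) (Q : X → X → Matrix (Fin N) (Fin N) ℂ) : Prop :=
  ∀ u, 0 ≤ QForm s Q u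

theorem BPSD.congr {X : Type*} {N : ℕ} {s : Finset X} {Q R : X → X → Matrix (Fin N) (Fin N) ℂ}
    (h : BPSD s Q) (e : ∀ i ∈ s, ∀ j ∈ s, Q i j = R i j) : BPSD s R := by
  intro u
  have := h u
  unfold QForm at *
  convert this using 1
  exact Finset.sum_congr rfl fun i hi => Finset.sum_congr rfl fun j hj => by rw [e i hi j hj]

theorem BPSD.add {X : Type*} {N : ℕ} {s : Finset X} {Q R : X → X → Matrix (Fin N) (Fin N) ℂ}
    (h : BPSD s Q) (h' : BPSD s R) : BPSD s (fun i j => Q i j + R i j) := by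
  intro u
  have := add_nonneg (h u) (h' u)
  unfold QForm at *
  convert this using 1
  simp [add_mulVec, dotProduct_add, Finset.sum_add_distrib]

theorem BPSD.mono {X : Type*} {N : ℕ} {s t : Finset X} {Q : X → X → Matrix (Fin N) (Fin N) ℂ}
    (h : BPSD t Q) (hst : s ⊆ t) : BPSD s Q := by
  classical
  intro u
  have := h (fun x => if x ∈ s then u x else 0)
  unfold QForm at *
  convert this using 1
  rw [← Finset.sum_subset hst]
  · refine Finset.sum_congr rfl fun i hi => ?_
    rw [← Finset.sum_subset hst]
    · refine Finset.sum_congr rfl fun j hj => ?_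
      simp [hi, hj]
    · intro j _ hj; simp [hj]
  · intro i _ hi
    simp [hi]

/-- sums of `B_i u_i` -/
def SB {X m : Type*} [Fintype m] {N : ℕ} (s : Finset X) (B : X → Matrix m (Fin N) ℂ) :
    (X → Fin N → ℂ) →ₗ[ℂ] EuclideanSpace ℂ m where
  toFun u := WithLp.toLp 2 (∑ i ∈ s, B i *ᵥ u i)
  map_add' u v := by simp [mulVec_add, Finset.sum_add_distrib]
  map_smul' c u := by simp [mulVec_smul, Finset.smul_sum]

theorem norm_SB {X m : Type*} [Fintype m] {N : ℕ} (s : Finset X) (B : X → Matrix m (Fin N) ℂ)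
    (u : X → Fin N → ℂ) :
    QForm s (fun i j => (B i)ᴴ * B j) u = ((‖SB s B u‖ ^ 2 : ℝ) : ℂ) := by
  have h := inner_self_eq_norm_sq_to_K (𝕜 := ℂ) (SB s B u)
  push_cast
  simp only [Complex.coe_algebraMap] at h
  rw [← h, EuclideanSpace.inner_eq_star_dotProduct]
  simp only [SB, LinearMap.coe_mk, AddHom.coe_mk, QForm, star_sum, dotProduct_sum, sum_dotProduct]
  refine Finset.sum_congr rfl fun i _ => Finset.sum_congr rfl fun j _ => ?_
  rw [star_mulVec, ← mulVec_mulVec, dotProduct_mulVec, dotProduct_comm]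

theorem BPSD.gram {X : Type*} {N : ℕ} {s : Finset X} {Q : X → X → Matrix (Fin N) (Fin N) ℂ}
    (h : BPSD s Q) : ∃ B : X → Matrix (s × Fin N) (Fin N) ℂ, ∀ i ∈ s, ∀ j ∈ s,
      Q i j = (B i)ᴴ * B j := by
  classical
  obtain ⟨B, hB⟩ := gram_of_form (T := s × Fin N) (fun a b => Q a.1 b.1 a.2 b.2) (by
    intro c
    have := h (fun x a => if hx : x ∈ s then c (⟨x, hx⟩, a) else 0)
    unfold QForm at this
    rw [← Finset.sum_coe_sort] at this
    simp only [← Finset.sum_coe_sort s] at this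
    convert this using 1
    simp only [Fintype.sum_prod_type, dotProduct, mulVec, Finset.mul_sum]
    refine Finset.sum_congr rfl fun i _ => ?_
    rw [Finset.sum_comm]
    refine Finset.sum_congr rfl fun j _ => Finset.sum_congr rfl fun a _ =>
      Finset.sum_congr rfl fun b _ => ?_
    simp [mul_assoc])
  refine ⟨fun x => Matrix.of fun m a => if hx : x ∈ s then B m (⟨x, hx⟩, a) else 0,
    fun i hi j hj => ?_⟩
  ext a b
  have := hB (⟨i, hi⟩, a) (⟨j, hj⟩, b)
  simp only at this
  rw [this]
  simp [Matrix.mul_apply, hi, hj]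

theorem bpsd_gram {X m : Type*} [Fintype m] {N : ℕ} (s : Finset X) (B : X → Matrix m (Fin N) ℂ) :
    BPSD s (fun i j => (B i)ᴴ * B j) := by
  intro u
  rw [norm_SB]
  exact Complex.zero_le_real.2 (sq_nonneg _)

theorem BPSD.schur {X : Type*} {N : ℕ} {s : Finset X} {Q : X → X → Matrix (Fin N) (Fin N) ℂ}
    (h : BPSD s Q) {p : X → X → ℂ} (hp : IsPosKernel p) : BPSD s (fun i j => p i j • Q i j) := by
  intro u
  obtain ⟨B, hB⟩ := posKernel_gram hp s
  have : QForm s (fun i j => p i j • Q i j) u = ∑ m, QForm s Q (fun x => B m x • u x) := by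
    unfold QForm
    rw [Finset.sum_comm (s := Finset.univ)]
    refine Finset.sum_congr rfl fun i hi => ?_
    rw [Finset.sum_comm (s := Finset.univ)]
    refine Finset.sum_congr rfl fun j hj => ?_
    simp only [hB i hi j hj]
    simp [smul_mulVec, mulVec_smul, Finset.sum_mul, mul_assoc, mul_left_comm]
  rw [this]
  exact Finset.sum_nonneg fun m _ => h _

theorem contraction_lift {E F G : Type*} [AddCommGroup E] [Module ℂ E]
    [NormedAddCommGroup F] [InnerProductSpace ℂ F] [FiniteDimensional ℂ F]
    [NormedAddCommGroup G] [InnerProductSpace ℂ G]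
    (f : E →ₗ[ℂ] F) (g : E →ₗ[ℂ] G) (h : ∀ x, ‖g x‖ ≤ ‖f x‖) :
    ∃ C : F →ₗ[ℂ] G, (∀ x, C (f x) = g x) ∧ ∀ y, ‖C y‖ ≤ ‖y‖ := by
  obtain ⟨r, hr⟩ := f.rangeRestrict.exists_rightInverse_of_surjective f.range_rangeRestrict
  have hr' : ∀ y : LinearMap.range f, f (r y) = y := fun y => by
    have := LinearMap.congr_fun hr y
    exact congrArg Subtype.val this
  refine ⟨(g ∘ₗ r) ∘ₗ (LinearMap.range f).orthogonalProjectionOnto.toLinearMap, fun x => ?_, fun y => ?_⟩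
  · have e : (LinearMap.range f).orthogonalProjectionOnto (f x) = ⟨f x, x, rfl⟩ :=
      Submodule.orthogonalProjectionOnto_mem_subspace_eq_self (⟨f x, x, rfl⟩ : LinearMap.range f)
    simp only [LinearMap.comp_apply, ContinuousLinearMap.coe_coe]
    rw [e, ← sub_eq_zero, ← map_sub, ← norm_le_zero_iff]
    refine (h _).trans ?_
    rw [map_sub, hr']
    simp
  · simp only [LinearMap.comp_apply, ContinuousLinearMap.coe_coe]
    refine (h _).trans ?_
    rw [hr']
    exact Submodule.norm_orthogonalProjectionOnto_apply_le _ _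

theorem QForm_sub {X : Type*} {N : ℕ} (s : Finset X) (Q R : X → X → Matrix (Fin N) (Fin N) ℂ)
    (u : X → Fin N → ℂ) :
    QForm s (fun i j => Q i j - R i j) u = QForm s Q u - QForm s R u := by
  simp [QForm, sub_mulVec, dotProduct_sub]

theorem QForm_congr {X : Type*} {N : ℕ} {s : Finset X} {Q R : X → X → Matrix (Fin N) (Fin N) ℂ}
    (e : ∀ i ∈ s, ∀ j ∈ s, Q i j = R i j) (u : X → Fin N → ℂ) : QForm s Q u = QForm s R u := by
  unfold QForm
  exact Finset.sum_congr rfl fun i hi => Finset.sum_congr rfl fun j hj => by rw [e i hi j hj]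

theorem bpsd_sub_iff {X m m' : Type*} [Fintype m] [Fintype m'] {N : ℕ} (s : Finset X)
    (B : X → Matrix m (Fin N) ℂ) (V : X → Matrix m' (Fin N) ℂ)
    (M : X → X → Matrix (Fin N) (Fin N) ℂ)
    (hM : ∀ i ∈ s, ∀ j ∈ s, M i j = (B i)ᴴ * B j) :
    BPSD s (fun i j => M i j - (V i)ᴴ * V j) ↔ ∀ u, ‖SB s V u‖ ≤ ‖SB s B u‖ := by
  unfold BPSD
  refine forall_congr' fun u => ?_
  rw [QForm_sub, norm_SB, QForm_congr hM, norm_SB, ← Complex.ofReal_sub, Complex.zero_le_real,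
    sub_nonneg, sq_le_sq₀ (norm_nonneg _) (norm_nonneg _)]

theorem one_block {X : Type*} [DecidableEq X] {N : ℕ} {s : Finset X} {y : X} (hy : y ∉ s)
    (M : X → X → Matrix (Fin N) (Fin N) ℂ) (V : X → Matrix (Fin N) (Fin N) ℂ)
    (hM : BPSD (insert y s) M) (hV : BPSD s (fun i j => M i j - (V i)ᴴ * V j)) :
    ∃ V0, BPSD (insert y s)
      (fun i j => M i j - (Function.update V y V0 i)ᴴ * (Function.update V y V0 j)) := by
  obtain ⟨B, hB⟩ := hM.gram
  rw [bpsd_sub_iff s B V M (fun i hi j hj =>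
    hB i (Finset.mem_insert_of_mem hi) j (Finset.mem_insert_of_mem hj))] at hV
  obtain ⟨C, hC, hC'⟩ := contraction_lift (SB s B) (SB s V) hV
  obtain ⟨Cm, rfl⟩ := (Matrix.toEuclideanLin (𝕜 := ℂ)).surjective C
  refine ⟨Cm * B y, ?_⟩
  rw [bpsd_sub_iff (insert y s) B _ M hB]
  intro u
  have e : SB (insert y s) (Function.update V y (Cm * B y)) u
      = Matrix.toEuclideanLin Cm (SB (insert y s) B u) := by
    have e1 : SB (insert y s) B u = WithLp.toLp 2 (B y *ᵥ u y) + SB s B u := by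
      simp [SB, Finset.sum_insert hy]
    have e2 : SB (insert y s) (Function.update V y (Cm * B y)) u
        = WithLp.toLp 2 ((Cm * B y) *ᵥ u y) + SB s V u := by
      simp only [SB, LinearMap.coe_mk, AddHom.coe_mk, Finset.sum_insert hy, Function.update_self,
        WithLp.toLp_add]
      congr 2
      refine Finset.sum_congr rfl fun i hi => ?_
      rw [Function.update_of_ne]
      rintro rfl; exact hy hi
    rw [e1, e2, map_add, hC]
    simp [Matrix.toLpLin_toLp]
  rw [e]
  exact hC' _

def PQ {X : Type*} {N : ℕ} (k ℓ : X → X → ℂ) (W : X → Matrix (Fin N) (Fin N) ℂ) (i j : X) :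
    Matrix (Fin N) (Fin N) ℂ := ℓ i j • (1 : Matrix (Fin N) (Fin N) ℂ) - k i j • (W i * (W j)ᴴ)

theorem bpsd_kernel {X : Type*} {N : ℕ} (s : Finset X) {r : X → X → ℂ} (hr : IsPosKernel r)
    (W : X → Matrix (Fin N) (Fin N) ℂ) : BPSD s (fun i j => r i j • (W i * (W j)ᴴ)) := by
  have := (bpsd_gram s (fun i => (W i)ᴴ)).schur hr
  simpa using this

theorem extend_one {X : Type*} [DecidableEq X] {N : ℕ} {k ℓ : X → X → ℂ}
    (hk : IsPosKernel k) (hℓ : IsPosKernel ℓ)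
    (hkd : ∀ x, 0 < k x x) (hℓd : ∀ x, 0 < ℓ x x)
    {p : X → X → X → ℂ} (hp : IsShimorinCertificate k ℓ p)
    {s : Finset X} {y : X} (hy : y ∉ s) (W : X → Matrix (Fin N) (Fin N) ℂ)
    (hW : BPSD s (PQ k ℓ W)) :
    ∃ W0, BPSD (insert y s) (PQ k ℓ (Function.update W y W0)) := by
  obtain ⟨hp1, hp2, hp3⟩ := hp y
  have hky : k y y ≠ 0 := (hkd y).ne'
  have hly : ℓ y y ≠ 0 := (hℓd y).ne'
  -- real square roots of the diagonal values
  have sq : ∀ a : ℂ, 0 < a → ∃ b : ℂ, b ≠ 0 ∧ star b = b ∧ b * b = a := by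
    intro a ha
    obtain ⟨h1, h2⟩ := Complex.lt_def.1 ha
    simp only [Complex.zero_re, Complex.zero_im] at h1 h2
    refine ⟨(Real.sqrt a.re : ℝ), ?_, ?_, ?_⟩
    · exact_mod_cast (Real.sqrt_pos.2 h1).ne'
    · exact Complex.conj_ofReal _
    · rw [← Complex.ofReal_mul, Real.mul_self_sqrt h1.le]
      apply Complex.ext <;> simp [h2]
  obtain ⟨a, ha0, has, haa⟩ := sq _ (hkd y)
  obtain ⟨b, hb0, hbs, hbb⟩ := sq _ (hℓd y)
  -- the shifted condition
  have hB : BPSD s (PQ (kerShift k y) (kerShift ℓ y) W) := by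
    have h1 := bpsd_kernel (N := N) s hp2 (fun _ => 1)
    have h2 := hW.schur hp1
    have h3 := bpsd_kernel (N := N) s hp3 W
    refine ((h1.add h2).add h3).congr fun i _ j _ => ?_
    simp only [PQ, conjTranspose_one, mul_one]
    module
  have hB' : BPSD (insert y s) (PQ (kerShift k y) (kerShift ℓ y) W) := by
    intro u
    have z1 : ∀ j, PQ (kerShift k y) (kerShift ℓ y) W y j = 0 := by
      intro j
      simp [PQ, kerShift, hky, hly]
    have z2 : ∀ j, PQ (kerShift k y) (kerShift ℓ y) W j y = 0 := by
      intro j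
      simp [PQ, kerShift, hky, hly]
    have := hB u
    unfold QForm at *
    simpa [Finset.sum_insert hy, z1, z2] using this
  have hM : BPSD (insert y s) (PQ (kerShift k y) ℓ W) := by
    have h1 := bpsd_gram (insert y s) (fun i => ((b⁻¹ * ℓ y i) • (1 : Matrix (Fin N) (Fin N) ℂ)))
    refine (hB'.add h1).congr fun i _ j _ => ?_
    simp only [PQ, conjTranspose_smul, star_mul', star_inv₀, hbs, posKernel_star hℓ,
      conjTranspose_one, kerShift, ← hbb, Matrix.smul_mul, Matrix.mul_smul, mul_one, smul_smul]
    match_scalars <;> field_simp <;> ring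
  obtain ⟨V0, hV0⟩ := one_block hy (PQ (kerShift k y) ℓ W) (fun i => (a⁻¹ * k y i) • (W i)ᴴ) hM (by
    refine hW.congr fun i _ j _ => ?_
    simp only [PQ, conjTranspose_smul, star_mul', star_inv₀, has, posKernel_star hk,
      conjTranspose_conjTranspose, kerShift, ← haa, Matrix.smul_mul, Matrix.mul_smul, smul_smul]
    match_scalars <;> field_simp <;> ring)
  refine ⟨a⁻¹ • V0ᴴ, hV0.congr fun i hi j hj => ?_⟩
  have key : ∀ i, Function.update (fun i => (a⁻¹ * k y i) • (W i)ᴴ) y V0 i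
      = (a⁻¹ * k y i) • (Function.update W y (a⁻¹ • V0ᴴ) i)ᴴ := by
    intro i
    by_cases h : i = y
    · subst h
      simp [has, smul_smul, ← haa]
      field_simp
      simp
    · simp [h]
  have key2 : PQ (kerShift k y) ℓ W i j = 
      PQ (kerShift k y) ℓ (Function.update W y (a⁻¹ • V0ᴴ)) i j := by
    by_cases h : i = y
    · subst h; simp [PQ, kerShift, hky]
    · by_cases h' : j = y
      · subst h'; simp [PQ, kerShift, hky]
      · simp [PQ, h, h']
  rw [key, key, key2]
  generalize Function.update W y (a⁻¹ • V0ᴴ) = W'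
  simp only [PQ, conjTranspose_smul, star_mul', star_inv₀, has, posKernel_star hk,
      conjTranspose_conjTranspose, kerShift, ← haa, Matrix.smul_mul, Matrix.mul_smul, smul_smul]
  match_scalars <;> field_simp <;> ring

theorem extend_finset {X : Type*} [DecidableEq X] {N : ℕ} {k ℓ : X → X → ℂ}
    (hk : IsPosKernel k) (hℓ : IsPosKernel ℓ)
    (hkd : ∀ x, 0 < k x x) (hℓd : ∀ x, 0 < ℓ x x)
    {p : X → X → X → ℂ} (hp : IsShimorinCertificate k ℓ p)
    {s0 : Finset X} (W : X → Matrix (Fin N) (Fin N) ℂ)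
    (hW : BPSD s0 (PQ k ℓ W)) (s : Finset X) :
    ∃ Φ : X → Matrix (Fin N) (Fin N) ℂ, (∀ x ∈ s0, Φ x = W x) ∧ BPSD (s ∪ s0) (PQ k ℓ Φ) := by
  induction s using Finset.induction_on with
  | empty => exact ⟨W, fun _ _ => rfl, by simpa using hW⟩
  | insert y s hys ih =>
    obtain ⟨Φ, h1, h2⟩ := ih
    by_cases hy : y ∈ s ∪ s0
    · refine ⟨Φ, h1, ?_⟩
      rwa [Finset.insert_union, Finset.insert_eq_of_mem hy]
    · obtain ⟨W0, h3⟩ := extend_one hk hℓ hkd hℓd hp hy Φ h2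
      refine ⟨Function.update Φ y W0, fun x hx => ?_, ?_⟩
      · rw [Function.update_of_ne, h1 x hx]
        rintro rfl
        exact hy (Finset.mem_union_right _ hx)
      · rwa [Finset.insert_union]

theorem PQ_bound {X : Type*} {N : ℕ} {k ℓ : X → X → ℂ}
    (hkd : ∀ x, 0 < k x x) {s : Finset X} {W : X → Matrix (Fin N) (Fin N) ℂ}
    (hW : BPSD s (PQ k ℓ W)) {x : X} (hx : x ∈ s) (a b : Fin N) :
    ‖W x a b‖ ≤ (ℓ x x).re / (k x x).re + 1 := by
  obtain ⟨B, hB⟩ := hW.gram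
  have h := congrFun (congrFun (hB x hx x hx) a) a
  obtain ⟨hk1, hk2⟩ := Complex.lt_def.1 (hkd x)
  simp only [Complex.zero_re, Complex.zero_im] at hk1 hk2
  have h' := congrArg Complex.re h
  simp only [PQ, Matrix.sub_apply, Matrix.smul_apply, Matrix.one_apply_eq, Matrix.mul_apply,
    Matrix.conjTranspose_apply, smul_eq_mul, mul_one, Complex.sub_re, Complex.mul_re, ← hk2,
    zero_mul, sub_zero, Complex.re_sum] at h'
  have e1 : ∀ w : ℂ, (w * star w).re = ‖w‖ ^ 2 := by
    intro w
    rw [← Complex.normSq_eq_norm_sq, Complex.normSq_apply]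
    simp
  have e2 : ∀ w : ℂ, (star w * w).re = ‖w‖ ^ 2 := by
    intro w; rw [mul_comm, e1]
  simp only [← Complex.mul_re, e1, e2] at h'
  have h3 : 0 ≤ ∑ m, ‖B x m a‖ ^ 2 := Finset.sum_nonneg fun _ _ => sq_nonneg _
  have h4 : ‖W x a b‖ ^ 2 ≤ ∑ c, ‖W x a c‖ ^ 2 :=
    Finset.single_le_sum (f := fun c => ‖W x a c‖ ^ 2) (fun _ _ => sq_nonneg _) (Finset.mem_univ b)
  have h5 : ‖W x a b‖ ^ 2 ≤ (ℓ x x).re / (k x x).re := by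
    rw [le_div_iff₀ hk1]
    nlinarith
  nlinarith [norm_nonneg (W x a b), sq_nonneg (‖W x a b‖ - 1)]

theorem extend_all {X : Type*} {N : ℕ} {k ℓ : X → X → ℂ}
    (hk : IsPosKernel k) (hℓ : IsPosKernel ℓ)
    (hkd : ∀ x, 0 < k x x) (hℓd : ∀ x, 0 < ℓ x x)
    {p : X → X → X → ℂ} (hp : IsShimorinCertificate k ℓ p)
    {s0 : Finset X} (W : X → Matrix (Fin N) (Fin N) ℂ)
    (hW : BPSD s0 (PQ k ℓ W)) :
    ∃ Φ : X → Matrix (Fin N) (Fin N) ℂ, (∀ x ∈ s0, Φ x = W x) ∧ ∀ s, BPSD s (PQ k ℓ Φ) := by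
  classical
  let K : Set (X → Matrix (Fin N) (Fin N) ℂ) :=
    Set.pi Set.univ fun x => Set.pi Set.univ fun _ => Set.pi Set.univ fun _ =>
      Metric.closedBall (0 : ℂ) ((ℓ x x).re / (k x x).re + 1)
  have hK : IsCompact K := isCompact_univ_pi fun x => isCompact_univ_pi fun _ =>
    isCompact_univ_pi fun _ => isCompact_closedBall _ _
  let T : Finset X → Set (X → Matrix (Fin N) (Fin N) ℂ) := fun s =>
    {Φ | (∀ x ∈ s0, Φ x = W x) ∧ BPSD s (PQ k ℓ Φ)}
  have hT : ∀ s, IsClosed (T s) := by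
    intro s
    have hc : ∀ x, Continuous fun Φ : X → Matrix (Fin N) (Fin N) ℂ => Φ x := fun x =>
      continuous_apply x
    have : T s = (⋂ x ∈ s0, {Φ | Φ x = W x}) ∩ ⋂ u, {Φ | 0 ≤ QForm s (PQ k ℓ Φ) u} := by
      ext Φ; simp [T, BPSD]
    rw [this]
    refine IsClosed.inter (isClosed_biInter fun x _ => isClosed_eq (hc x) continuous_const)
      (isClosed_iInter fun u => ?_)
    have : OrderClosedTopology ℂ := Complex.orderClosedTopology
    refine isClosed_le continuous_const ?_
    unfold QForm PQ
    refine continuous_finsetSum _ fun i _ => continuous_finsetSum _ fun j _ => ?_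
    refine Continuous.dotProduct continuous_const (Continuous.matrix_mulVec ?_ continuous_const)
    have hm := Continuous.matrix_mul (hc i) (hc j).matrix_conjTranspose
    have hm' : Continuous fun Φ : X → Matrix (Fin N) (Fin N) ℂ => k i j • (Φ i * (Φ j)ᴴ) :=
      hm.const_smul (k i j)
    exact continuous_const.sub hm'
  obtain ⟨Φ, -, hΦ⟩ := hK.inter_iInter_nonempty T hT (by
    intro F
    obtain ⟨Φ, h1, h2⟩ := extend_finset hk hℓ hkd hℓd hp W hW (F.sup id)
    let t := F.sup id ∪ s0
    let Ψ : X → Matrix (Fin N) (Fin N) ℂ := fun x => if x ∈ t then Φ x else 0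
    have hΨ : BPSD t (PQ k ℓ Ψ) := h2.congr fun i hi j hj => by
      simp only [PQ, Ψ, if_pos (show i ∈ t from hi), if_pos (show j ∈ t from hj)]
    refine ⟨Ψ, ?_, ?_⟩
    · intro x _ a _ b _
      rw [mem_closedBall_zero_iff]
      by_cases hx : x ∈ t
      · exact PQ_bound hkd hΨ hx a b
      · simp only [Ψ, if_neg hx, Matrix.zero_apply, norm_zero]
        have := (Complex.lt_def.1 (hkd x)).1
        have := (Complex.lt_def.1 (hℓd x)).1
        simp only [Complex.zero_re] at *
        positivity
    · simp only [Set.mem_iInter]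
      intro s hs
      refine ⟨fun x hx => ?_, hΨ.mono ?_⟩
      · simp only [Ψ, if_pos (show x ∈ t from Finset.mem_union_right _ hx), h1 x hx]
      · exact (Finset.le_sup (f := id) hs).trans Finset.subset_union_left)
  simp only [Set.mem_iInter] at hΦ
  exact ⟨Φ, (hΦ ∅).1, fun s => (hΦ s).2⟩

theorem BPSD.tuple {X : Type*} {N : ℕ} {Q : X → X → Matrix (Fin N) (Fin N) ℂ}
    (h : ∀ s, BPSD s Q) {n : ℕ} (z : Fin n → X) (u : Fin n → Fin N → ℂ) :
    0 ≤ ∑ i, ∑ j, star (u i) ⬝ᵥ (Q (z i) (z j) *ᵥ u j) := by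
  classical
  obtain ⟨B, hB⟩ := (h (Finset.univ.image z)).gram
  have := bpsd_gram Finset.univ (fun i => B (z i)) u
  unfold QForm at this
  convert this using 1
  refine Finset.sum_congr rfl fun i _ => Finset.sum_congr rfl fun j _ => ?_
  rw [hB _ (by simp) _ (by simp)]

theorem PQ_unique {X : Type*} {N : ℕ} {k ℓ : X → X → ℂ} (hkd : ∀ x, 0 < k x x) {s : Finset X}
    {W : X → Matrix (Fin N) (Fin N) ℂ} (hW : BPSD s (PQ k ℓ W)) {x y : X} (hx : x ∈ s)
    (hy : y ∈ s) (k1 : k x y = k x x) (k2 : k y x = k x x) (k3 : k y y = k x x)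
    (l1 : ℓ x y = ℓ x x) (l2 : ℓ y x = ℓ x x) (l3 : ℓ y y = ℓ x x) : W x = W y := by
  obtain ⟨B, hB⟩ := hW.gram
  have e : (B x - B y)ᴴ * (B x - B y) = - (k x x • ((W x - W y) * (W x - W y)ᴴ)) := by
    simp only [conjTranspose_sub, Matrix.sub_mul, Matrix.mul_sub, ← hB x hx x hx, ← hB x hx y hy,
      ← hB y hy x hx, ← hB y hy y hy, PQ, k1, k2, k3, l1, l2, l3]
    module
  have h1 := (Matrix.posSemidef_conjTranspose_mul_self (B x - B y)).trace_nonneg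
  have h2 := (Matrix.posSemidef_self_mul_conjTranspose (W x - W y)).trace_nonneg
  rw [e, trace_neg, trace_smul, smul_eq_mul] at h1
  have h3 := mul_nonneg (hkd x).le h2
  have h4 : k x x * ((W x - W y) * (W x - W y)ᴴ).trace = 0 :=
    le_antisymm (by simpa using h1) h3
  have h5 := (mul_eq_zero.1 h4).resolve_left (hkd x).ne'
  rw [Matrix.trace_mul_conjTranspose_self_eq_zero_iff] at h5
  exact sub_eq_zero.1 h5

theorem IsPosKernel.comp {X Y : Type*} {r : X → X → ℂ} (hr : IsPosKernel r) (f : Y → X) :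
    IsPosKernel fun a b => r (f a) (f b) :=
  fun m w c => hr m (fun i => f (w i)) c

theorem IsShimorinCertificate.comp {X Y : Type*} {k ℓ : X → X → ℂ} {p : X → X → X → ℂ}
    (hp : IsShimorinCertificate k ℓ p) (f : Y → X) :
    IsShimorinCertificate (fun a b => k (f a) (f b)) (fun a b => ℓ (f a) (f b))
      (fun c a b => p (f c) (f a) (f b)) := fun c =>
  ⟨(hp (f c)).1.comp f, (hp (f c)).2.1.comp f, (hp (f c)).2.2.comp f⟩

/-- If the pair `(k, ℓ)` possesses a Shimorin certificate, then `(k, ℓ)` is a complete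
Pick pair. -/
theorem shimorin_certificate_sufficiency {X : Type*} [Nonempty X] (k ℓ : X → X → ℂ)
    (hk : IsPosKernel k) (hℓ : IsPosKernel ℓ)
    (hkd : ∀ x, 0 < k x x) (hℓd : ∀ x, 0 < ℓ x x)
    (p : X → X → X → ℂ) (hp : IsShimorinCertificate k ℓ p) :
    IsCompletePickPair k ℓ := by
  intro n N _ _ z W hW
  let π : Fin n ⊕ X → X := Sum.elim z id
  let k' : Fin n ⊕ X → Fin n ⊕ X → ℂ := fun a b => k (π a) (π b)
  let ℓ' : Fin n ⊕ X → Fin n ⊕ X → ℂ := fun a b => ℓ (π a) (π b)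
  have hkd' : ∀ a, 0 < k' a a := fun a => hkd _
  obtain ⟨Φ, h1, h2⟩ := extend_all (N := N) (k := k') (ℓ := ℓ') (hk.comp π) (hℓ.comp π) hkd' (fun a => hℓd (π a))
    (hp.comp π) (s0 := Finset.univ.map Function.Embedding.inl) (Sum.elim W fun _ => 0) (by
      intro u
      have := hW (fun i => u (Sum.inl i))
      simpa [QForm, PQ, π, k', ℓ'] using this)
  refine ⟨fun x => Φ (Sum.inr x), fun m y u => ?_, fun i => ?_⟩
  · have := BPSD.tuple h2 (fun i => Sum.inr (y i)) u
    simpa [PQ, π, k', ℓ'] using this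
  · classical
    have := PQ_unique (k := k') (ℓ := ℓ') (W := Φ) (x := Sum.inr (z i)) (y := Sum.inl i) hkd'
      (h2 {Sum.inl i, Sum.inr (z i)}) (by simp) (by simp) rfl rfl rfl rfl rfl rfl
    simp only [this]
    rw [h1 _ (by simp)]
    simp
end
end
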